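/- Let n ≥ 7 be an integer with n ≡ 1 (mod 3), and let T be a perfect tiling subset of G for parameter n. Then 2·|{g ∈ G : m₃(g) ≥ 1}| = 3 − |T ∩ T^(3)| + Σ_{g ∈ G, m₃(g) ≥ 1} (m₃(g) − 1)(m₃(g) − 2). -/

import Mathlib

/-- `T` is a perfect tiling subset of `G` for parameter `n`:
`|G| = 2n²+1`, `|T| = 2n+1`, `e ∈ T`, `T = T⁽⁻¹⁾`, and
`T·T = 2·G + T⁽²⁾ + (2n-2)·e` in the integral group ring `ℤ[G]`. -/
def IsPerfectTilingSubset (n : ℕ) {G : Type} [CommGroup G] [Fintype G] [DecidableEq G]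
    (T : Finset G) : Prop :=
  Fintype.card G = 2 * n ^ 2 + 1 ∧
  T.card = 2 * n + 1 ∧
  (1 : G) ∈ T ∧
  T = T.image (·⁻¹) ∧
  (∑ t ∈ T, MonoidAlgebra.single t (1 : ℤ)) * (∑ t ∈ T, MonoidAlgebra.single t (1 : ℤ))
    = 2 * (∑ g : G, MonoidAlgebra.single g (1 : ℤ))
      + (∑ t ∈ T, MonoidAlgebra.single (t ^ 2) (1 : ℤ))
      + MonoidAlgebra.single (1 : G) (2 * (n : ℤ) - 2)

/-- `m3 T g`: the number of pairs `(t₁,t₂) ∈ T × T` with `t₁·t₂³ = g`,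
i.e. the coefficient of `g` in the group-ring product `T·T⁽³⁾`. -/
def m3 {G : Type} [CommGroup G] [DecidableEq G] (T : Finset G) (g : G) : ℕ :=
  ((T ×ˢ T).filter (fun p => p.1 * p.2 ^ 3 = g)).card


lemma tile_lift {n : ℕ} {G : Type} [CommGroup G] [Fintype G] [DecidableEq G]
    {T : Finset G} (hT : IsPerfectTilingSubset n T) {A : Type} [CommRing A] (f : G →* A) :
    (∑ t ∈ T, f t) * (∑ t ∈ T, f t) = 2 * (∑ g : G, f g) + (∑ t ∈ T, f (t ^ 2)) + (2 * (n : A) - 2) := by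
  obtain ⟨_, _, _, _, h⟩ := hT
  have := congrArg (MonoidAlgebra.lift ℤ A G f) h
  have h2 : (MonoidAlgebra.lift ℤ A G f) 2 = 2 := map_ofNat _ 2
  simpa [map_sum, MonoidAlgebra.lift_single, h2] using this

lemma coeff_sum_of {R G ι : Type} [CommRing R] [CommGroup G] [DecidableEq G]
    (s : Finset ι) (h : ι → G) (g : G) :
    (∑ i ∈ s, MonoidAlgebra.of R G (h i)).coeff g = ((s.filter (fun i => h i = g)).card : R) := by
  rw [MonoidAlgebra.coeff_sum, Finsupp.finsetSum_apply, Finset.card_filter]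
  push_cast
  refine Finset.sum_congr rfl fun i _ => ?_
  rw [MonoidAlgebra.of_apply, MonoidAlgebra.coeff_single, Finsupp.single_apply]

lemma exists_cubic {G : Type} [CommGroup G] [Fintype G] (h : 3 ∣ Fintype.card G) :
    ∃ φ : G →* Multiplicative (ZMod 3), Function.Surjective φ := by
  classical
  have : Fact (Nat.Prime 3) := ⟨by norm_num⟩
  let cube : G →* G := powMonoidHom 3
  have hns : ¬ Function.Surjective cube := by
    intro hs
    have hi := Finite.injective_iff_surjective.mpr hs
    obtain ⟨x, hx⟩ := exists_prime_orderOf_dvd_card 3 h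
    have h1 : cube x = cube 1 := by
      simp [cube, ← hx, pow_orderOf_eq_one]
    have := hi h1
    simp [this] at hx
  rw [← MonoidHom.range_eq_top] at hns
  obtain ⟨x, hx⟩ : ∃ x, x ∉ cube.range := by
    by_contra! hc
    exact hns (by ext; simp [hc])
  let Q := Additive (G ⧸ cube.range)
  let _ : Module (ZMod 3) Q := AddCommGroup.zmodModule (n := 3) (by
    intro q
    obtain ⟨g, hg⟩ := QuotientGroup.mk_surjective (Additive.toMul q)
    have : q = Additive.ofMul (QuotientGroup.mk g) := by rw [hg]; rfl
    rw [this, ← ofMul_pow, ← QuotientGroup.mk_pow, ofMul_eq_zero, QuotientGroup.eq_one_iff]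
    exact ⟨g, rfl⟩)
  have hne : (Additive.ofMul (QuotientGroup.mk x : G ⧸ cube.range) : Q) ≠ 0 := by
    rw [Ne, ofMul_eq_zero, QuotientGroup.eq_one_iff]; exact hx
  obtain ⟨l, hl⟩ : ∃ l : Q →ₗ[ZMod 3] ZMod 3, l (Additive.ofMul (QuotientGroup.mk x : G ⧸ cube.range)) ≠ 0 := by
    by_contra! hc
    exact hne ((Module.forall_dual_apply_eq_zero_iff (ZMod 3) _).1 hc)
  refine ⟨(AddMonoidHom.toMultiplicativeRight l.toAddMonoidHom).comp (QuotientGroup.mk' cube.range), ?_⟩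
  intro z
  obtain ⟨q, hq⟩ := LinearMap.surjective (f := l) (by rintro rfl; simp at hl) (Multiplicative.toAdd z)
  obtain ⟨g, hg⟩ := QuotientGroup.mk_surjective (Additive.toMul q)
  refine ⟨g, ?_⟩
  change Multiplicative.ofAdd (l (Additive.ofMul (QuotientGroup.mk g : G ⧸ cube.range))) = z
  rw [hg]
  change Multiplicative.ofAdd (l q) = z
  rw [hq]; rfl

lemma m3_mod {n : ℕ} (hmod : n % 3 = 1) {G : Type} [CommGroup G] [Fintype G] [DecidableEq G]
    {T : Finset G} (hT : IsPerfectTilingSubset n T) (g : G) (hg : g ∉ T.image (· ^ 4)) :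
    2 ≤ m3 T g := by
  have : Fact (Nat.Prime 3) := ⟨by norm_num⟩
  let A := MonoidAlgebra (ZMod 3) G
  have : CharP A 3 := charP_of_injective_algebraMap (R := ZMod 3) (A := A) (FaithfulSMul.algebraMap_injective _ _) 3
  let f : G →* A := MonoidAlgebra.of (ZMod 3) G
  have h3 : (3 : A) = 0 := by exact_mod_cast CharP.cast_eq_zero A 3
  obtain ⟨k, hk⟩ : ∃ k, n = 3 * k + 1 := ⟨n / 3, by omega⟩
  have hnA : (n : A) = 1 := by rw [hk]; push_cast; rw [h3]; ring
  set S : A := ∑ g : G, f g with hS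
  have e1 := tile_lift hT f
  have e2 := tile_lift hT (f.comp (powMonoidHom 2))
  have hodd : Nat.Coprime (Nat.card G) 2 := by
    rw [Nat.card_eq_fintype_card, hT.1]; 
    rw [Nat.coprime_two_right]; exact ⟨n^2, rfl⟩
  have hsq : ∑ g : G, f (g ^ 2) = S := by
    exact Fintype.sum_equiv (powCoprime hodd) _ _ (fun x => rfl)
  have habs : ∀ x : G, S * f x = S := by
    intro x
    rw [hS, Finset.sum_mul]
    exact Fintype.sum_equiv (Equiv.mulRight x) _ _ (fun y => by simp)
  have hSS : S * S = 0 := by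
    conv_lhs => rw [hS, ← hS]
    nth_rewrite 2 [hS]
    rw [Finset.mul_sum, Finset.sum_congr rfl (fun x _ => habs x), Finset.sum_const, Finset.card_univ, hT.1,
      nsmul_eq_mul]
    push_cast
    rw [hnA]; linear_combination S * h3
  have hST : S * ∑ t ∈ T, f (t ^ 2) = 0 := by
    rw [Finset.mul_sum, Finset.sum_congr rfl (fun x _ => habs _), Finset.sum_const, hT.2.1,
      nsmul_eq_mul]
    push_cast
    rw [hnA]; linear_combination S * h3
  simp only [MonoidHom.comp_apply, powMonoidHom_apply] at e2
  rw [hsq, hnA] at e2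
  rw [← hS, hnA] at e1
  have hcube : (∑ t ∈ T, f t) ^ 3 = ∑ t ∈ T, f (t ^ 3) := by
    rw [sum_pow_char]; simp
  have key : (∑ t ∈ T, f t) * (∑ t ∈ T, f (t ^ 3)) = 2 * S + ∑ t ∈ T, f (t ^ 4) := by
    have h4 : ∀ t : G, (t ^ 2) ^ 2 = t ^ 4 := fun t => by rw [← pow_mul]
    simp only [h4] at e2
    rw [← hcube]
    calc (∑ t ∈ T, f t) * (∑ t ∈ T, f t) ^ 3
        = ((∑ t ∈ T, f t) * (∑ t ∈ T, f t)) * ((∑ t ∈ T, f t) * (∑ t ∈ T, f t)) := by ring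
      _ = _ := by
        rw [e1]
        linear_combination 4 * hSS + 4 * hST + e2
  have hc := congrArg (fun a : A => a.coeff g) key
  have hm : (m3 T g : ZMod 3) = 2 := by
    have hl : (m3 T g : ZMod 3) = ((∑ t ∈ T, f t) * (∑ t ∈ T, f (t ^ 3)) : A).coeff g := by
      rw [Finset.sum_mul_sum, ← Finset.sum_product']
      simp only [← map_mul]
      exact (coeff_sum_of (R := ZMod 3) (T ×ˢ T) (fun p => p.1 * p.2 ^ 3) g).symm
    rw [hl, key]
    have : (2 : A) * S = S + S := by ring
    rw [this]
    have hz : (∑ t ∈ T, f (t ^ 4) : A).coeff g = 0 := by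
      refine (coeff_sum_of (R := ZMod 3) T (fun t => t ^ 4) g).trans ?_
      rw [Finset.filter_eq_empty_iff.2, Finset.card_empty, Nat.cast_zero]
      intro t ht h
      exact hg (Finset.mem_image.2 ⟨t, ht, h⟩)
    have hs : S.coeff g = 1 := by
      refine (coeff_sum_of (R := ZMod 3) Finset.univ (fun t => t) g).trans ?_
      simp [Finset.filter_eq']
    rw [MonoidAlgebra.coeff_add, MonoidAlgebra.coeff_add, Finsupp.add_apply, Finsupp.add_apply, hz, hs]
    ring
  have hm' : ((m3 T g : ℕ) : ZMod 3) = ((2 : ℕ) : ZMod 3) := by rw [hm]; norm_cast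
  rw [ZMod.natCast_eq_natCast_iff'] at hm'
  omega

lemma fiber_ineq {n : ℕ} (hmod : n % 3 = 1) {G : Type} [CommGroup G] [Fintype G] [DecidableEq G]
    {T : Finset G} (hT : IsPerfectTilingSubset n T) (φ : G →* Multiplicative (ZMod 3))
    (c : Multiplicative (ZMod 3)) :
    2 * (Finset.univ.filter (fun g => φ g = c)).card
      ≤ (2 * n + 3) * (T.filter (fun t => φ t = c)).card := by
  have h3 : ∀ z : Multiplicative (ZMod 3), z ^ 3 = 1 := by decide
  have h4 : ∀ z : Multiplicative (ZMod 3), z ^ 4 = z := by decide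
  set F := Finset.univ.filter (fun g => φ g = c)
  set X := T.filter (fun t => φ t = c)
  have hsum : ∑ g ∈ F, m3 T g = X.card * (2 * n + 1) := by
    rw [← hT.2.1, ← Finset.card_product]
    have := Finset.card_eq_sum_card_fiberwise (s := X ×ˢ T) (t := F)
      (f := fun p : G × G => p.1 * p.2 ^ 3) (by
        intro p hp
        have hp := Finset.mem_product.1 hp
        simp only [X, Finset.mem_filter] at hp
        simp [F, h3, hp.1.2])
    rw [this]
    refine Finset.sum_congr rfl fun g hg => ?_
    unfold m3
    congr 1
    ext p
    simp only [Finset.mem_filter, Finset.mem_product, X]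
    have hg' : φ g = c := (Finset.mem_filter.1 hg).2
    constructor
    · rintro ⟨⟨h1, h2⟩, h⟩
      refine ⟨⟨⟨h1, ?_⟩, h2⟩, h⟩
      rw [← hg', ← h]; simp [h3]
    · rintro ⟨⟨⟨h1, _⟩, h2⟩, h⟩
      exact ⟨⟨h1, h2⟩, h⟩
  have hsub : (F \ X.image (· ^ 4)).card * 2 ≤ ∑ g ∈ F, m3 T g := by
    rw [← smul_eq_mul]
    refine (Finset.card_nsmul_le_sum _ (m3 T) 2 ?_).trans
      (Finset.sum_le_sum_of_subset Finset.sdiff_subset)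
    intro g hg
    rw [Finset.mem_sdiff] at hg
    apply m3_mod hmod hT
    intro hm
    obtain ⟨t, ht, rfl⟩ := Finset.mem_image.1 hm
    apply hg.2
    refine Finset.mem_image.2 ⟨t, Finset.mem_filter.2 ⟨ht, ?_⟩, rfl⟩
    have := (Finset.mem_filter.1 hg.1).2
    simpa [h4] using this
  have h5 := Finset.le_card_sdiff (X.image (· ^ 4)) F
  have h6 : (X.image (· ^ 4)).card ≤ X.card := Finset.card_image_le
  nlinarith [(by omega : F.card ≤ (F \ X.image (· ^ 4)).card + X.card)]

lemma fiber_sq {n : ℕ} {G : Type} [CommGroup G] [Fintype G] [DecidableEq G]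
    {T : Finset G} (hT : IsPerfectTilingSubset n T) (φ : G →* Multiplicative (ZMod 3)) :
    ∑ t ∈ T, ((T.filter (fun s => φ s = (φ t)⁻¹)).card : ℤ)
      = 2 * ((Finset.univ.filter (fun g => φ g = 1)).card : ℤ)
        + ((T.filter (fun t => φ t = 1)).card : ℤ) + (2 * n - 2) := by
  have h2 : ∀ z : Multiplicative (ZMod 3), z ^ 2 = 1 ↔ z = 1 := by decide
  have e := tile_lift hT ((MonoidAlgebra.of ℤ (Multiplicative (ZMod 3))).comp φ)
  simp only [MonoidHom.comp_apply, map_pow φ, Finset.sum_mul_sum, ← Finset.sum_product', ← map_mul] at e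
  simp only [map_mul φ] at e
  have h1 : (2 * (n : MonoidAlgebra ℤ (Multiplicative (ZMod 3))) - 2)
      = MonoidAlgebra.single 1 (2 * (n : ℤ) - 2) := by
    have h : ((2 * (n : ℤ) - 2 : ℤ) : MonoidAlgebra ℤ (Multiplicative (ZMod 3))) = _ :=
      MonoidAlgebra.intCast_def _
    push_cast at h
    rw [h]
  rw [h1, two_mul] at e
  have e' := congrArg (fun a => MonoidAlgebra.coeff a 1) e
  simp only [MonoidAlgebra.coeff_add, Finsupp.add_apply] at e'
  rw [coeff_sum_of (T ×ˢ T) (fun p => φ p.1 * φ p.2), coeff_sum_of _ (fun p => φ p),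
    coeff_sum_of _ (fun p => φ p ^ 2), MonoidAlgebra.coeff_single, Finsupp.single_eq_same] at e'
  simp only [h2] at e'
  rw [two_mul, ← e', Finset.card_filter, Finset.sum_product]
  push_cast
  refine Finset.sum_congr rfl fun t _ => ?_
  rw [Finset.card_filter]
  push_cast
  refine Finset.sum_congr rfl fun s _ => ?_
  simp only [mul_eq_one_iff_eq_inv']

lemma no_tiling (n : ℕ) (hn : 7 ≤ n) (hmod : n % 3 = 1)
    {G : Type} [CommGroup G] [Fintype G] [DecidableEq G]
    (T : Finset G) (hT : IsPerfectTilingSubset n T) : False := by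
  have hd : 3 ∣ Fintype.card G := by
    rw [hT.1]
    obtain ⟨k, rfl⟩ : ∃ k, n = 3 * k + 1 := ⟨n / 3, by omega⟩
    exact ⟨6 * k ^ 2 + 4 * k + 1, by ring⟩
  obtain ⟨φ, hφ⟩ := exists_cubic hd
  let w : Multiplicative (ZMod 3) := Multiplicative.ofAdd 1
  have hcase : ∀ z : Multiplicative (ZMod 3), z = 1 ∨ z = w ∨ z = w⁻¹ := by decide
  have hw1 : w ≠ 1 := by decide
  have hw2 : w⁻¹ ≠ 1 := by decide
  have hw3 : w⁻¹ ≠ w := by decide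
  have hu : (Finset.univ : Finset (Multiplicative (ZMod 3))) = {1, w, w⁻¹} := by decide
  -- fiber sizes
  have hfib : ∀ c, (Finset.univ.filter (fun g => φ g = c)).card
      = (Finset.univ.filter (fun g => φ g = 1)).card := by
    intro c
    exact MonoidHom.card_fiber_eq_of_mem_range φ (hφ c) (hφ 1)
  have hsplit : ∀ S : Finset G, S.card = (S.filter (fun g => φ g = 1)).card
      + (S.filter (fun g => φ g = w)).card + (S.filter (fun g => φ g = w⁻¹)).card := by
    intro S
    rw [Finset.card_eq_sum_card_fiberwise (f := φ) (t := Finset.univ) (fun _ _ => Finset.mem_coe.2 (Finset.mem_univ _)), hu,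
      Finset.sum_insert (by decide), Finset.sum_insert (by decide), Finset.sum_singleton]
    ring
  have hG := hsplit Finset.univ
  rw [hfib w, hfib w⁻¹, Finset.card_univ, hT.1] at hG
  have hTs := hsplit T
  have hinvT : ∀ t ∈ T, t⁻¹ ∈ T := by
    intro t ht
    rw [hT.2.2.2.1]
    exact Finset.mem_image_of_mem _ ht
  have hsym : (T.filter (fun g => φ g = w⁻¹)).card = (T.filter (fun g => φ g = w)).card := by
    refine Finset.card_bij' (fun t _ => t⁻¹) (fun t _ => t⁻¹) ?_ ?_ ?_ ?_
    · intro t ht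
      rw [Finset.mem_filter] at ht ⊢
      exact ⟨hinvT _ ht.1, by simp [ht.2]⟩
    · intro t ht
      rw [Finset.mem_filter] at ht ⊢
      exact ⟨hinvT _ ht.1, by simp [ht.2]⟩
    · simp
    · simp
  rw [hsym, hT.2.1] at hTs
  have hsq := fiber_sq hT φ
  have hi1 := fiber_ineq hmod hT φ 1
  have hi2 := fiber_ineq hmod hT φ w
  rw [hfib w] at hi2
  have hsq2 : ∑ t ∈ T, ((T.filter (fun s => φ s = (φ t)⁻¹)).card : ℤ)
      = ((T.filter (fun t => φ t = 1)).card : ℤ) ^ 2 + 2 * ((T.filter (fun t => φ t = w)).card : ℤ) ^ 2 := by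
    rw [← Finset.sum_fiberwise T φ, hu,
      Finset.sum_insert (by decide), Finset.sum_insert (by decide), Finset.sum_singleton]
    have hc : ∀ c, ∑ t ∈ T.filter (fun t => φ t = c), ((T.filter (fun s => φ s = (φ t)⁻¹)).card : ℤ)
        = (T.filter (fun t => φ t = c)).card * ((T.filter (fun s => φ s = c⁻¹)).card : ℤ) := by
      intro c
      rw [Finset.sum_congr rfl (g := fun _ => ((T.filter (fun s => φ s = c⁻¹)).card : ℤ)), Finset.sum_const, nsmul_eq_mul]
      intro t ht
      rw [(Finset.mem_filter.1 ht).2]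
    rw [hc, hc, hc, inv_one, inv_inv, hsym]
    ring
  rw [hsq2] at hsq
  generalize (T.filter (fun t => φ t = 1)).card = x at *
  generalize (T.filter (fun t => φ t = w)).card = y at *
  generalize (Finset.univ.filter (fun t => φ t = 1)).card = f at *
  clear * - hn hmod hG hTs hsq hi1 hi2
  have hq : ((x : ℤ) - y) * ((x : ℤ) - y - 1) = 2 * n - 2 := by
    zify at hG hTs
    have : (y : ℤ) * 2 = 2 * n + 1 - x := by linarith
    nlinarith
  obtain ⟨a, ha⟩ : ∃ a : ℤ, a = x - y := ⟨_, rfl⟩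
  rw [← ha] at hq
  zify at hG hTs hi1 hi2 hn
  have hx : 3 * (x : ℤ) = 2 * n + 1 + 2 * a := by linarith
  have hy : 3 * (y : ℤ) = 2 * n + 1 - a := by linarith
  have hf : 3 * (f : ℤ) = 2 * n ^ 2 + 1 := by linarith
  have ha3 : a % 3 = 0 := by omega
  have h1 : a * (2 * n + 3) ≤ 8 * n + 1 := by nlinarith
  have h2 : -2 * a * (2 * n + 3) ≤ 8 * n + 1 := by nlinarith
  have hlt : a < 4 := by nlinarith
  have hgt : -2 < a := by nlinarith
  have : a = 0 ∨ a = 3 := by omega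
  rcases this with rfl | rfl <;> linarith

theorem stmt10 (n : ℕ) (hn : 7 ≤ n) (hmod : n % 3 = 1)
    {G : Type} [CommGroup G] [Fintype G] [DecidableEq G]
    (T : Finset G) (hT : IsPerfectTilingSubset n T) :
    (2 : ℤ) * ((Finset.univ.filter (fun g : G => 1 ≤ m3 T g)).card)
      = 3 - ((T ∩ T.image (· ^ 3)).card : ℤ)
        + ∑ g ∈ Finset.univ.filter (fun g : G => 1 ≤ m3 T g),
            ((m3 T g : ℤ) - 1) * ((m3 T g : ℤ) - 2) := by
  exact (no_tiling n hn hmod T hT).elim
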